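/- Let J ⊆ S be a subset of the simple generators, W_J the standard parabolic subgroup, and I_J ⊆ RΛ_J the closed imaginary cone of (W_J, J), viewed inside RΛ. Then I_J ⊆ I. Moreover, if v ∈ I is a nonnegative combination of simple roots α_{s'} with s' ∈ J and all coefficients nonzero, then v ∈ I_J. -/

import Mathlib

noncomputable def coxEntry {B : Type*} (M : CoxeterMatrix B) (s t : B) : ℝ :=
  if M s t = 0 then -2 else -2 * Real.cos (Real.pi / (M s t))

noncomputable def coxForm {B : Type*} [Fintype B] (M : CoxeterMatrix B) (v w : B → ℝ) : ℝ :=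
  ∑ s, ∑ t, v s * w t * coxEntry M s t

/-- The simple root `α_s` in `RΛ ≅ (B → ℝ)`. -/
noncomputable def simpleRoot {B : Type*} [DecidableEq B] (s : B) : B → ℝ := Pi.single s 1

/-- The set of real roots: the `W`-orbit of the simple roots under the Tits representation. -/
def rootSet {B : Type*} [DecidableEq B] {W : Type*} [Group W]
    (ρ : W →* ((B → ℝ) ≃ₗ[ℝ] (B → ℝ))) : Set (B → ℝ) :=
  {v | ∃ (w : W) (s : B), v = ρ w (simpleRoot s)}

/-- The set of positive real roots. -/
def posRootSet {B : Type*} [DecidableEq B] {W : Type*} [Group W]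
    (ρ : W →* ((B → ℝ) ≃ₗ[ℝ] (B → ℝ))) : Set (B → ℝ) :=
  {v ∈ rootSet ρ | ∀ i, 0 ≤ v i}

/-- The set `K = {v ∈ ℝ_{≥0}Λ : B(v, α_s) ≤ 0 for all s}`. -/
noncomputable def coneK {B : Type*} [Fintype B] [DecidableEq B] (M : CoxeterMatrix B) :
    Set (B → ℝ) :=
  {v | (∀ i, 0 ≤ v i) ∧ ∀ s, coxForm M v (simpleRoot s) ≤ 0}

/-- The closed imaginary cone `I = closure (W · K)`. -/
noncomputable def imagCone {B : Type*} [Fintype B] [DecidableEq B] (M : CoxeterMatrix B)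
    {W : Type*} [Group W] (ρ : W →* ((B → ℝ) ≃ₗ[ℝ] (B → ℝ))) : Set (B → ℝ) :=
  closure {v | ∃ (w : W), ∃ k ∈ coneK M, v = ρ w k}


/-- The set `K_J` for a subset `J` of the simple generators: vectors in the nonnegative span of
the simple roots `α_{s'}`, `s' ∈ J`, pairing nonpositively with every `α_{s'}`, `s' ∈ J`. -/
noncomputable def coneKJ {B : Type*} [Fintype B] [DecidableEq B] (M : CoxeterMatrix B)
    (J : Set B) : Set (B → ℝ) :=
  {v | (∀ i, 0 ≤ v i) ∧ (∀ i ∉ J, v i = 0) ∧ ∀ s ∈ J, coxForm M v (simpleRoot s) ≤ 0}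

/-- The closed imaginary cone of the standard parabolic subsystem `(W_J, J)`, viewed inside
`RΛ`: the closure of the `W_J`-orbit of `K_J`. -/
noncomputable def imagConeJ {B : Type*} [Fintype B] [DecidableEq B] (M : CoxeterMatrix B)
    {W : Type*} [Group W] (cs : CoxeterSystem M W)
    (ρ : W →* ((B → ℝ) ≃ₗ[ℝ] (B → ℝ))) (J : Set B) : Set (B → ℝ) :=
  closure {v | ∃ w ∈ Subgroup.closure (cs.simple '' J), ∃ k ∈ coneKJ M J, v = ρ w k}

set_option linter.unusedSectionVars false
section Helpers

variable {B : Type*} [Fintype B] [DecidableEq B] (M : CoxeterMatrix B)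

lemma coxEntry_comm (s t : B) : coxEntry M s t = coxEntry M t s := by
  unfold coxEntry
  rw [M.symmetric s t]

lemma coxEntry_self (s : B) : coxEntry M s s = 2 := by
  simp [coxEntry]

lemma coxEntry_nonpos {s t : B} (h : s ≠ t) : coxEntry M s t ≤ 0 := by
  unfold coxEntry
  split_ifs with h0
  · norm_num
  · have h1 : M s t ≠ 1 := M.off_diagonal s t h
    have h2 : (2 : ℝ) ≤ M s t := by
      have : 2 ≤ M s t := by omega
      exact_mod_cast this
    have : 0 ≤ Real.cos (Real.pi / (M s t)) := by
      apply Real.cos_nonneg_of_neg_pi_div_two_le_of_le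
      · have : 0 ≤ Real.pi / (M s t) := by positivity
        linarith [Real.pi_pos]
      · exact div_le_div_of_nonneg_left Real.pi_pos.le (by norm_num) h2
    linarith

lemma coxEntry_abs_le (s t : B) : |coxEntry M s t| ≤ 2 := by
  unfold coxEntry
  split_ifs with h0
  · norm_num
  · rw [abs_mul]
    have := Real.abs_cos_le_one (Real.pi / (M s t))
    norm_num
    linarith

lemma coxForm_comm (v w : B → ℝ) : coxForm M v w = coxForm M w v := by
  unfold coxForm
  rw [Finset.sum_comm]
  refine Finset.sum_congr rfl fun s _ => Finset.sum_congr rfl fun t _ => ?_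
  rw [coxEntry_comm M t s]; ring

lemma coxForm_add_left (u v w : B → ℝ) :
    coxForm M (u + v) w = coxForm M u w + coxForm M v w := by
  simp only [coxForm, ← Finset.sum_add_distrib, Pi.add_apply]
  refine Finset.sum_congr rfl fun s _ => Finset.sum_congr rfl fun t _ => ?_
  ring

lemma coxForm_smul_left (c : ℝ) (v w : B → ℝ) :
    coxForm M (c • v) w = c * coxForm M v w := by
  simp only [coxForm, Finset.mul_sum, Pi.smul_apply, smul_eq_mul]
  refine Finset.sum_congr rfl fun s _ => Finset.sum_congr rfl fun t _ => ?_
  ring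

lemma coxForm_sub_left (u v w : B → ℝ) :
    coxForm M (u - v) w = coxForm M u w - coxForm M v w := by
  have := coxForm_add_left M (u - v) v w
  rw [sub_add_cancel] at this
  linarith

lemma coxForm_add_right (u v w : B → ℝ) :
    coxForm M w (u + v) = coxForm M w u + coxForm M w v := by
  rw [coxForm_comm, coxForm_add_left, coxForm_comm M u, coxForm_comm M v]

lemma coxForm_smul_right (c : ℝ) (v w : B → ℝ) :
    coxForm M w (c • v) = c * coxForm M w v := by
  rw [coxForm_comm, coxForm_smul_left, coxForm_comm M v]

lemma coxForm_sub_right (u v w : B → ℝ) :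
    coxForm M w (u - v) = coxForm M w u - coxForm M w v := by
  rw [coxForm_comm, coxForm_sub_left, coxForm_comm M u, coxForm_comm M v]

lemma coxForm_simpleRoot (v : B → ℝ) (s : B) :
    coxForm M v (simpleRoot s) = ∑ t, v t * coxEntry M t s := by
  unfold coxForm simpleRoot
  refine Finset.sum_congr rfl fun t _ => ?_
  rw [Finset.sum_eq_single s]
  · simp
  · intro b _ hb; simp [hb]
  · simp

lemma coxForm_simpleRoot_simpleRoot (s t : B) :
    coxForm M (simpleRoot s) (simpleRoot t) = coxEntry M s t := by
  rw [coxForm_simpleRoot, Finset.sum_eq_single s]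
  · simp [simpleRoot]
  · intro b _ hb; simp [simpleRoot, hb]
  · simp

lemma coxForm_eq_sum (v w : B → ℝ) :
    coxForm M v w = ∑ s, w s * coxForm M v (simpleRoot s) := by
  simp only [coxForm_simpleRoot, Finset.mul_sum]
  unfold coxForm
  rw [Finset.sum_comm]
  refine Finset.sum_congr rfl fun s _ => Finset.sum_congr rfl fun t _ => ?_
  ring

/-- height -/
noncomputable def ht (v : B → ℝ) : ℝ := ∑ i, v i

lemma ht_add (v w : B → ℝ) : ht (v + w) = ht v + ht w := by
  simp [ht, Finset.sum_add_distrib]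
lemma ht_sub (v w : B → ℝ) : ht (v - w) = ht v - ht w := by
  simp [ht]
lemma ht_smul (c : ℝ) (w : B → ℝ) : ht (c • w) = c * ht w := by
  simp [ht, Finset.mul_sum]
lemma ht_simpleRoot (s : B) : ht (simpleRoot s) = 1 := by
  simp [ht, simpleRoot]
lemma ht_nonneg {v : B → ℝ} (h : ∀ i, 0 ≤ v i) : 0 ≤ ht v := Finset.sum_nonneg fun i _ => h i

lemma simpleRoot_nonneg (s i : B) : 0 ≤ simpleRoot s i := by
  unfold simpleRoot
  by_cases h : i = s
  · subst h; simp
  · simp [h]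

lemma one_le_ht {v : B → ℝ} (h : ∀ i, 0 ≤ v i) (h2 : coxForm M v v = 2) : 1 ≤ ht v := by
  have h3 : coxForm M v v ≤ 2 * (ht v * ht v) := by
    unfold coxForm ht
    rw [Finset.sum_mul_sum, Finset.mul_sum]
    simp only [Finset.mul_sum]
    refine Finset.sum_le_sum fun s _ => Finset.sum_le_sum fun t _ => ?_
    have h4 := (abs_le.1 (coxEntry_abs_le M s t)).2
    nlinarith [mul_nonneg (h s) (h t)]
  have := ht_nonneg h
  nlinarith

variable {W : Type*} [Group W] (cs : CoxeterSystem M W)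
    (ρ : W →* ((B → ℝ) ≃ₗ[ℝ] (B → ℝ)))

lemma rho_mul (w w' : W) (v : B → ℝ) : ρ (w * w') v = ρ w (ρ w' v) := by
  rw [map_mul]; rfl

lemma rho_one (v : B → ℝ) : ρ 1 v = v := by
  rw [map_one]; rfl


lemma form_inv
    (hρ : ∀ (s : B) (v : B → ℝ),
      ρ (cs.simple s) v = v - coxForm M (simpleRoot s) v • simpleRoot s)
    (w : W) (u v : B → ℝ) : coxForm M (ρ w u) (ρ w v) = coxForm M u v := by
  induction w using cs.simple_induction_left generalizing u v with
  | one => simp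
  | mul_simple_left w s ih =>
    rw [rho_mul, rho_mul, hρ, hρ, ← ih u v]
    generalize ρ w u = x
    generalize ρ w v = y
    simp only [coxForm_sub_left, coxForm_sub_right, coxForm_smul_left, coxForm_smul_right,
      coxForm_simpleRoot_simpleRoot, coxEntry_self]
    rw [coxForm_comm M x (simpleRoot s)]
    ring

lemma refl_simpleRoot_self
    (hρ : ∀ (s : B) (v : B → ℝ),
      ρ (cs.simple s) v = v - coxForm M (simpleRoot s) v • simpleRoot s)
    (s : B) : ρ (cs.simple s) (simpleRoot s) = - simpleRoot s := by
  rw [hρ, coxForm_simpleRoot_simpleRoot, coxEntry_self]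
  ext i; simp; ring

lemma refl_simpleRoot
    (hρ : ∀ (s : B) (v : B → ℝ),
      ρ (cs.simple s) v = v - coxForm M (simpleRoot s) v • simpleRoot s)
    (s t : B) :
    ρ (cs.simple s) (simpleRoot t) = simpleRoot t - coxEntry M s t • simpleRoot s := by
  rw [hρ, coxForm_simpleRoot_simpleRoot]

lemma dihedral
    (hρ : ∀ (s : B) (v : B → ℝ),
      ρ (cs.simple s) v = v - coxForm M (simpleRoot s) v • simpleRoot s)
    (s t : B) (p : ℕ → ℝ) (p0 : p 0 = 0) (p1 : p 1 = 1)
    (pp : ∀ k, p (k + 2) = - coxEntry M s t * p (k + 1) - p k) (k : ℕ) :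
    ρ (cs.wordProd (CoxeterSystem.alternatingWord s t k)) (simpleRoot s) =
      if Even k then p (k + 1) • simpleRoot s + p k • simpleRoot t
      else p k • simpleRoot s + p (k + 1) • simpleRoot t := by
  induction k with
  | zero => simp [CoxeterSystem.alternatingWord, p0, p1]
  | succ k ih =>
    rw [CoxeterSystem.alternatingWord_succ', cs.wordProd_cons, rho_mul, ih]
    by_cases hk : Even k
    · have hk' : ¬ Even (k + 1) := by simpa [Nat.even_add_one] using hk
      rw [if_pos hk, if_pos hk, if_neg hk', map_add, map_smul, map_smul,
        refl_simpleRoot_self M cs ρ hρ, refl_simpleRoot M cs ρ hρ, pp k, coxEntry_comm M t s]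
      module
    · have hk' : Even (k + 1) := by simpa [Nat.even_add_one] using hk
      rw [if_neg hk, if_neg hk, if_pos hk', map_add, map_smul, map_smul,
        refl_simpleRoot_self M cs ρ hρ, refl_simpleRoot M cs ρ hρ, pp k]
      module

lemma exists_cheb {s t : B} (h : s ≠ t) : ∃ p : ℕ → ℝ, p 0 = 0 ∧ p 1 = 1 ∧
    (∀ k, p (k + 2) = - coxEntry M s t * p (k + 1) - p k) ∧
    ∀ k, (M s t ≠ 0 → k ≤ M s t) → 0 ≤ p k := by
  unfold coxEntry
  by_cases h0 : M s t = 0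
  · refine ⟨fun k => k, by simp, by simp, ?_, ?_⟩
    · intro k; rw [if_pos h0]; push_cast; ring
    · intro k _; positivity
  · have h1 : M s t ≠ 1 := M.off_diagonal s t h
    have h2 : (2 : ℝ) ≤ M s t := by
      have : 2 ≤ M s t := by omega
      exact_mod_cast this
    set θ : ℝ := Real.pi / (M s t) with hθ
    have hm : (M s t : ℝ) * θ = Real.pi := by rw [hθ]; field_simp
    have hθ0 : 0 < θ := by have := Real.pi_pos; positivity
    have hs : 0 < Real.sin θ := by
      apply Real.sin_pos_of_pos_of_lt_pi hθ0
      nlinarith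
    refine ⟨fun k => Real.sin (k * θ) / Real.sin θ, by simp, ?_, ?_, ?_⟩
    · simp [hs.ne']
    · intro k
      rw [if_neg h0]
      have e1 : Real.sin (((k + 2 : ℕ) : ℝ) * θ) + Real.sin (k * θ) =
          2 * Real.cos θ * Real.sin (((k + 1 : ℕ) : ℝ) * θ) := by
        have a1 : ((k + 2 : ℕ) : ℝ) * θ = ((k + 1 : ℕ) : ℝ) * θ + θ := by push_cast; ring
        have a2 : (k : ℝ) * θ = ((k + 1 : ℕ) : ℝ) * θ - θ := by push_cast; ring
        rw [a1, a2, Real.sin_add, Real.sin_sub]; ring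
      have e2 := eq_sub_of_add_eq e1
      simp only [e2]
      ring
    · intro k hk
      have hk' : (k : ℝ) ≤ M s t := by exact_mod_cast hk h0
      apply div_nonneg _ hs.le
      apply Real.sin_nonneg_of_nonneg_of_le_pi
      · positivity
      · nlinarith

theorem root_nonneg
    (hρ : ∀ (s : B) (v : B → ℝ),
      ρ (cs.simple s) v = v - coxForm M (simpleRoot s) v • simpleRoot s)
    (w : W) (s : B) (hw : cs.length w < cs.length (w * cs.simple s)) :
    ∀ i, 0 ≤ ρ w (simpleRoot s) i := by
  induction hn : cs.length w using Nat.strong_induction_on generalizing w s with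
  | _ n IH =>
  subst hn
  by_cases hw1 : w = 1
  · subst hw1
    intro i; rw [rho_one]; exact simpleRoot_nonneg s i
  obtain ⟨t, ht⟩ := cs.exists_rightDescent_of_ne_one hw1
  have hst : s ≠ t := by
    rintro rfl
    unfold CoxeterSystem.IsRightDescent at ht
    omega
  rw [cs.isRightDescent_iff] at ht
  let P : ℕ → Prop := fun k => ∃ v, w = v * cs.wordProd (CoxeterSystem.alternatingWord s t k) ∧
    cs.length w = cs.length v + k
  have P1 : P 1 := by
    refine ⟨w * cs.simple t, ?_, ht.symm⟩
    simp [CoxeterSystem.alternatingWord]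
  have Pdown : ∀ k, P (k + 1) → P k := by
    rintro k ⟨v, h1, h2⟩
    rw [CoxeterSystem.alternatingWord_succ', cs.wordProd_cons, ← mul_assoc] at h1
    refine ⟨_, h1, ?_⟩
    have a1 := cs.length_mul_le (v * cs.simple (if Even k then t else s))
      (cs.wordProd (CoxeterSystem.alternatingWord s t k))
    have a2 := cs.length_wordProd_le (CoxeterSystem.alternatingWord s t k)
    have a3 := cs.length_mul_le v (cs.simple (if Even k then t else s))
    rw [← h1] at a1
    rw [CoxeterSystem.length_alternatingWord] at a2
    rw [cs.length_simple] at a3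
    omega
  have Pdown' : ∀ k j, P (k + j) → P k := by
    intro k j
    induction j with
    | zero => exact id
    | succ j ih => exact fun h => ih (Pdown _ h)
  obtain ⟨k, hk1, ⟨v, hv1, hv2⟩, hk3⟩ : ∃ k, 1 ≤ k ∧ P k ∧ ¬ P (k + 1) := by
    by_contra! hcon
    have : ∀ k, P (k + 1) := by
      intro k
      induction k with
      | zero => exact P1
      | succ k ih => exact hcon _ (by omega) ih
    obtain ⟨v, _, h⟩ := this (cs.length w)
    omega
  have hkM : M s t ≠ 0 → k + 1 ≤ M s t := by
    intro h0
    by_contra hlt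
    have : P (M s t) := by
      apply Pdown' (M s t) (k - M s t)
      have : M s t + (k - M s t) = k := by omega
      rw [this]
      exact ⟨v, hv1, hv2⟩
    obtain ⟨v', h1, h2⟩ := this
    have hb := cs.wordProd_braidWord_eq s t
    unfold CoxeterSystem.braidWord at hb
    rw [hb, M.symmetric t s] at h1
    obtain ⟨m, hm⟩ := Nat.exists_eq_succ_of_ne_zero h0
    rw [hm, Nat.succ_eq_add_one, CoxeterSystem.alternatingWord_succ, cs.wordProd_concat] at h1
    have h3 : w * cs.simple s = v' * cs.wordProd (CoxeterSystem.alternatingWord s t m) := by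
      rw [h1]; simp [mul_assoc]
    have a1 := cs.length_mul_le v' (cs.wordProd (CoxeterSystem.alternatingWord s t m))
    have a2 := cs.length_wordProd_le (CoxeterSystem.alternatingWord s t m)
    rw [CoxeterSystem.length_alternatingWord] at a2
    rw [h3] at hw
    omega
  -- the two letters
  have A1 : cs.length v < cs.length (v * cs.simple (if Even k then s else t)) := by
    obtain ⟨j, rfl⟩ : ∃ j, k = j + 1 := ⟨k - 1, by omega⟩
    rw [CoxeterSystem.alternatingWord_succ', cs.wordProd_cons, ← mul_assoc] at hv1
    have e : (if Even j then t else s) = (if Even (j + 1) then s else t) := by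
      by_cases hj : Even j <;> simp [Nat.even_add_one, hj]
    rw [e] at hv1
    have a1 := cs.length_mul_le (v * cs.simple (if Even (j + 1) then s else t))
      (cs.wordProd (CoxeterSystem.alternatingWord s t j))
    have a2 := cs.length_wordProd_le (CoxeterSystem.alternatingWord s t j)
    rw [← hv1] at a1
    rw [CoxeterSystem.length_alternatingWord] at a2
    omega
  have A2 : cs.length v < cs.length (v * cs.simple (if Even k then t else s)) := by
    by_contra hcon
    apply hk3
    refine ⟨v * cs.simple (if Even k then t else s), ?_, ?_⟩
    · rw [CoxeterSystem.alternatingWord_succ', cs.wordProd_cons, mul_assoc,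
        CoxeterSystem.simple_mul_simple_cancel_left, hv1]
    · rcases cs.length_mul_simple v (if Even k then t else s) with h | h <;> omega
  have A3 : cs.length v < cs.length (v * cs.simple s) ∧
      cs.length v < cs.length (v * cs.simple t) := by
    by_cases hk : Even k
    · simp only [hk, if_true] at A1 A2; exact ⟨A1, A2⟩
    · simp only [hk, if_false] at A1 A2; exact ⟨A2, A1⟩
  have B1 := IH (cs.length v) (by omega) v s A3.1 rfl
  have B2 := IH (cs.length v) (by omega) v t A3.2 rfl
  obtain ⟨p, p0, p1, pp, ppos⟩ := exists_cheb M hst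
  have q1 := ppos k (fun h => by have := hkM h; omega)
  have q2 := ppos (k + 1) hkM
  intro i
  rw [hv1, rho_mul, dihedral M cs ρ hρ s t p p0 p1 pp k]
  split_ifs
  · rw [map_add, map_smul, map_smul]
    exact add_nonneg (mul_nonneg q2 (B1 i)) (mul_nonneg q1 (B2 i))
  · rw [map_add, map_smul, map_smul]
    exact add_nonneg (mul_nonneg q1 (B1 i)) (mul_nonneg q2 (B2 i))

lemma root_descent_nonpos
    (hρ : ∀ (s : B) (v : B → ℝ),
      ρ (cs.simple s) v = v - coxForm M (simpleRoot s) v • simpleRoot s)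
    (w : W) (s : B) (hw : cs.IsRightDescent w s) :
    ∀ i, ρ w (simpleRoot s) i ≤ 0 := by
  intro i
  have h := root_nonneg M cs ρ hρ (w * cs.simple s) s
    (by simpa [mul_assoc, CoxeterSystem.IsRightDescent] using hw) i
  rw [rho_mul, refl_simpleRoot_self M cs ρ hρ, map_neg] at h
  simpa using h

lemma coneK_orbit_nonneg
    (hρ : ∀ (s : B) (v : B → ℝ),
      ρ (cs.simple s) v = v - coxForm M (simpleRoot s) v • simpleRoot s)
    (k : B → ℝ) (hk : k ∈ coneK M) (w : W) : ∀ i, 0 ≤ ρ w k i := by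
  induction hn : cs.length w using Nat.strong_induction_on generalizing w with
  | _ n IH =>
  subst hn
  by_cases hw1 : w = 1
  · subst hw1; intro i; rw [rho_one]; exact hk.1 i
  obtain ⟨s, hs⟩ := cs.exists_rightDescent_of_ne_one hw1
  intro i
  have h1 := IH (cs.length (w * cs.simple s)) hs (w * cs.simple s) rfl i
  have h2 := root_descent_nonpos M cs ρ hρ w s hs i
  have h3 := hk.2 s
  rw [rho_mul, hρ, map_sub, map_smul, coxForm_comm] at h1
  simp only [Pi.sub_apply, Pi.smul_apply, smul_eq_mul] at h1
  nlinarith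

lemma parabolic_coeff
    (hρ : ∀ (s : B) (v : B → ℝ),
      ρ (cs.simple s) v = v - coxForm M (simpleRoot s) v • simpleRoot s)
    (J : Set B) (w : W) (hw : w ∈ Subgroup.closure (cs.simple '' J)) :
    ∀ (v : B → ℝ) (i : B), i ∉ J → ρ w v i = v i := by
  induction hw using Subgroup.closure_induction with
  | mem x hx =>
    obtain ⟨s, hs, rfl⟩ := hx
    intro v i hi
    have : i ≠ s := by rintro rfl; exact hi hs
    rw [hρ]; simp [simpleRoot, this]
  | one => intro v i _; rw [rho_one]
  | mul x y _ _ hx hy => intro v i hi; rw [rho_mul, hx _ i hi, hy _ i hi]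
  | inv x _ hx =>
    intro v i hi
    rw [← hx (ρ x⁻¹ v) i hi, ← rho_mul, mul_inv_cancel, rho_one]

lemma parabolic_fix
    (hρ : ∀ (s : B) (v : B → ℝ),
      ρ (cs.simple s) v = v - coxForm M (simpleRoot s) v • simpleRoot s)
    (J : Set B) (v : B → ℝ) (hv : ∀ s ∈ J, coxForm M (simpleRoot s) v = 0)
    (w : W) (hw : w ∈ Subgroup.closure (cs.simple '' J)) : ρ w v = v := by
  induction hw using Subgroup.closure_induction with
  | mem x hx =>
    obtain ⟨s, hs, rfl⟩ := hx
    rw [hρ, hv s hs]; simp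
  | one => rw [rho_one]
  | mul x y _ _ hx hy => rw [rho_mul, hy, hx]
  | inv x _ hx =>
    nth_rw 1 [← hx]
    rw [← rho_mul, inv_mul_cancel, rho_one]

lemma parabolic_descent
    (hρ : ∀ (s : B) (v : B → ℝ),
      ρ (cs.simple s) v = v - coxForm M (simpleRoot s) v • simpleRoot s)
    (J : Set B) (w : W) (hw : w ∈ Subgroup.closure (cs.simple '' J))
    (s : B) (hs : cs.IsRightDescent w s) : s ∈ J := by
  by_contra hsJ
  have h1 := root_descent_nonpos M cs ρ hρ w s hs s
  rw [parabolic_coeff M cs ρ hρ J w hw _ s hsJ] at h1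
  simp [simpleRoot] at h1
  linarith

lemma ht_growth
    (hρ : ∀ (s : B) (v : B → ℝ),
      ρ (cs.simple s) v = v - coxForm M (simpleRoot s) v • simpleRoot s)
    (J : Set B) (k : B → ℝ) (c : ℝ) (hc : 0 ≤ c)
    (hk : ∀ s ∈ J, coxForm M k (simpleRoot s) ≤ -c)
    (w : W) (hw : w ∈ Subgroup.closure (cs.simple '' J)) :
    ht k + c * cs.length w ≤ ht (ρ w k) := by
  induction hn : cs.length w using Nat.strong_induction_on generalizing w with
  | _ n IH =>
  subst hn
  by_cases hw1 : w = 1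
  · subst hw1; rw [rho_one]; simp
  obtain ⟨s, hs⟩ := cs.exists_rightDescent_of_ne_one hw1
  have hsJ := parabolic_descent M cs ρ hρ J w hw s hs
  have hs' := cs.isRightDescent_iff.1 hs
  have h1 := IH (cs.length (w * cs.simple s)) hs (w * cs.simple s)
    (mul_mem hw (Subgroup.subset_closure ⟨s, hsJ, rfl⟩)) rfl
  have h2 : 1 ≤ ht (-(ρ w (simpleRoot s))) := by
    apply one_le_ht M
    · intro i
      have := root_descent_nonpos M cs ρ hρ w s hs i
      simpa using this
    · rw [← map_neg, form_inv M cs ρ hρ, ← refl_simpleRoot_self M cs ρ hρ,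
        form_inv M cs ρ hρ, coxForm_simpleRoot_simpleRoot, coxEntry_self]
  have h3 := hk s hsJ
  have h4 : ht (-(ρ w (simpleRoot s))) = - ht (ρ w (simpleRoot s)) := by simp [ht]
  rw [h4] at h2
  rw [rho_mul, hρ, map_sub, map_smul, coxForm_comm, ht_sub, ht_smul] at h1
  rw [← hs']
  push_cast
  nlinarith

lemma finite_length_le (N : ℕ) : {w : W | cs.length w ≤ N}.Finite := by
  refine ((List.finite_length_le B N).image cs.wordProd).subset ?_
  intro w hw
  obtain ⟨ω, h1, h2⟩ := cs.exists_isReduced w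
  refine ⟨ω, ?_, h2.symm⟩
  have := h1.eq
  rw [← h2] at this
  simp only [Set.mem_ofPred_eq] at hw ⊢
  omega

/-- nonneg orbit under the parabolic with attained minimum -/
lemma mem_orbit_of_growth
    (hρ : ∀ (s : B) (v : B → ℝ),
      ρ (cs.simple s) v = v - coxForm M (simpleRoot s) v • simpleRoot s)
    (J : Set B) (v : B → ℝ) (hv : ∀ i ∉ J, v i = 0)
    (hpos : ∀ w ∈ Subgroup.closure (cs.simple '' J), ∀ i, 0 ≤ ρ w v i)
    (c : ℝ) (hc : 0 < c)
    (hg : ∀ w ∈ Subgroup.closure (cs.simple '' J), c * cs.length w ≤ ht (ρ w v)) :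
    ∃ w ∈ Subgroup.closure (cs.simple '' J), ∃ k ∈ coneKJ M J, v = ρ w k := by
  obtain ⟨N, hN⟩ := exists_nat_ge (ht v / c)
  have hfin : {w : W | w ∈ Subgroup.closure (cs.simple '' J) ∧ cs.length w ≤ N}.Finite :=
    (finite_length_le M cs N).subset fun w hw => hw.2
  obtain ⟨w, ⟨hw1, hw2⟩, hmin⟩ := Set.exists_min_image _ (fun w => ht (ρ w v)) hfin
    ⟨1, one_mem _, by simp⟩
  have hmin' : ∀ w' ∈ Subgroup.closure (cs.simple '' J), ht (ρ w v) ≤ ht (ρ w' v) := by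
    intro w' hw'
    by_cases hl : cs.length w' ≤ N
    · exact hmin w' ⟨hw', hl⟩
    · have h1 := hmin 1 ⟨one_mem _, by simp⟩
      have h2 := hg w' hw'
      simp only [rho_one] at h1
      have h3 : (N : ℝ) ≤ cs.length w' := by exact_mod_cast (not_le.1 hl).le
      rw [div_le_iff₀ hc] at hN
      nlinarith
  refine ⟨w⁻¹, inv_mem hw1, ρ w v, ⟨hpos w hw1, ?_, ?_⟩, ?_⟩
  · intro i hi; rw [parabolic_coeff M cs ρ hρ J w hw1 v i hi, hv i hi]
  · intro s hs
    have h1 := hmin' (cs.simple s * w) (mul_mem (Subgroup.subset_closure ⟨s, hs, rfl⟩) hw1)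
    rw [rho_mul, hρ, ht_sub, ht_smul, ht_simpleRoot, coxForm_comm] at h1
    linarith
  · rw [← rho_mul, inv_mul_cancel, rho_one]

/-- The indefinite case. -/
lemma case_strict
    (hρ : ∀ (s : B) (v : B → ℝ),
      ρ (cs.simple s) v = v - coxForm M (simpleRoot s) v • simpleRoot s)
    (J : Set B) (v : B → ℝ) (hv : ∀ i ∉ J, v i = 0)
    (hpos : ∀ w ∈ Subgroup.closure (cs.simple '' J), ∀ i, 0 ≤ ρ w v i)
    (x : B → ℝ) (hx : ∀ i, 0 ≤ x i) (hxJ : ∀ i ∉ J, x i = 0)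
    (hxs : ∀ s ∈ J, coxForm M x (simpleRoot s) < 0) : v ∈ imagConeJ M cs ρ J := by
  obtain ⟨c, hc, hxc⟩ : ∃ c : ℝ, 0 < c ∧ ∀ s ∈ J, coxForm M x (simpleRoot s) ≤ -c := by
    rcases J.eq_empty_or_nonempty with rfl | hne
    · exact ⟨1, one_pos, by simp⟩
    · obtain ⟨s, hs, hm⟩ := Set.exists_max_image J (fun s => coxForm M x (simpleRoot s))
        (Set.toFinite J) hne
      exact ⟨- coxForm M x (simpleRoot s), by linarith [hxs s hs], fun t ht => by
        linarith [hm t ht]⟩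
  have hxK : x ∈ coneK M := by
    refine ⟨hx, fun s => ?_⟩
    by_cases hs : s ∈ J
    · exact (hxs s hs).le
    · rw [coxForm_simpleRoot]
      apply Finset.sum_nonpos
      intro t _
      by_cases ht : t = s
      · subst ht; simp [hxJ _ hs]
      · exact mul_nonpos_of_nonneg_of_nonpos (hx t) (coxEntry_nonpos M ht)
  have key : ∀ ε : ℝ, 0 < ε → v + ε • x ∈
      {v | ∃ w ∈ Subgroup.closure (cs.simple '' J), ∃ k ∈ coneKJ M J, v = ρ w k} := by
    intro ε hε
    apply mem_orbit_of_growth M cs ρ hρ J (v + ε • x) _ _ (ε * c) (by positivity)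
    · intro w hw
      have h1 := ht_growth M cs ρ hρ J x c hc.le hxc w hw
      have h2 := ht_nonneg hx
      have h3 := ht_nonneg (hpos w hw)
      rw [map_add, map_smul, ht_add, ht_smul]
      nlinarith
    · intro i hi; simp [hv i hi, hxJ i hi]
    · intro w hw i
      rw [map_add, map_smul]
      exact add_nonneg (hpos w hw i) (mul_nonneg hε.le (coneK_orbit_nonneg M cs ρ hρ x hxK w i))
  have hlim : Filter.Tendsto (fun ε : ℝ => v + ε • x) (nhdsWithin 0 (Set.Ioi 0)) (nhds v) := by
    have : Continuous (fun ε : ℝ => v + ε • x) := by fun_prop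
    have h := this.tendsto 0
    simp only [zero_smul, add_zero] at h
    exact h.mono_left nhdsWithin_le_nhds
  exact mem_closure_of_tendsto hlim (by
    filter_upwards [self_mem_nhdsWithin] with ε hε using key ε hε)

/-- The positive semidefinite case. -/
lemma case_psd
    (hρ : ∀ (s : B) (v : B → ℝ),
      ρ (cs.simple s) v = v - coxForm M (simpleRoot s) v • simpleRoot s)
    (J : Set B) (v : B → ℝ) (hv : ∀ i ∉ J, v i = 0)
    (hpos : ∀ w ∈ Subgroup.closure (cs.simple '' J), ∀ i, 0 ≤ ρ w v i)
    (y : B → ℝ) (hy : ∀ i ∈ J, 0 < y i) (hyJ : ∀ i ∉ J, y i = 0)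
    (hys : ∀ s ∈ J, 0 ≤ coxForm M y (simpleRoot s)) : v ∈ imagConeJ M cs ρ J := by
  have hy0 : ∀ i, 0 ≤ y i := fun i => by
    by_cases hi : i ∈ J
    · exact (hy i hi).le
    · exact (hyJ i hi).ge
  -- positive semidefiniteness
  have psd : ∀ x : B → ℝ, (∀ i ∉ J, x i = 0) → 0 ≤ coxForm M x x := by
    intro x hx
    let z : B → ℝ := fun i => x i / y i
    have hz : ∀ i, x i = y i * z i := by
      intro i
      by_cases hi : i ∈ J
      · have := (hy i hi).ne'
        simp only [z]; field_simp
      · rw [hx i hi, hyJ i hi, zero_mul]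
    have e1 : ∑ s, ∑ t, (y s * y t * coxEntry M s t) * ((z s ^ 2 + z t ^ 2) / 2) ≤
        coxForm M x x := by
      unfold coxForm
      refine Finset.sum_le_sum fun s _ => Finset.sum_le_sum fun t _ => ?_
      rw [hz s, hz t]
      by_cases hst : s = t
      · subst hst; apply le_of_eq; ring
      · have h1 := coxEntry_nonpos M hst
        have h2 : y s * y t * coxEntry M s t ≤ 0 :=
          mul_nonpos_of_nonneg_of_nonpos (mul_nonneg (hy0 s) (hy0 t)) h1
        nlinarith [sq_nonneg (z s - z t), mul_nonneg (neg_nonneg.2 h2) (sq_nonneg (z s - z t))]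
    have e2 : ∑ s, ∑ t, (y s * y t * coxEntry M s t) * ((z s ^ 2 + z t ^ 2) / 2) =
        ∑ t, z t ^ 2 * y t * coxForm M y (simpleRoot t) := by
      have e3 : ∑ s, ∑ t, (y s * y t * coxEntry M s t) * (z s ^ 2 / 2) =
          ∑ s, ∑ t, (y s * y t * coxEntry M s t) * (z t ^ 2 / 2) := by
        rw [Finset.sum_comm]
        refine Finset.sum_congr rfl fun s _ => Finset.sum_congr rfl fun t _ => ?_
        rw [coxEntry_comm M t s]; ring
      have e4 : ∑ s, ∑ t, (y s * y t * coxEntry M s t) * ((z s ^ 2 + z t ^ 2) / 2) =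
          ∑ s, ∑ t, (y s * y t * coxEntry M s t) * (z s ^ 2 / 2) +
          ∑ s, ∑ t, (y s * y t * coxEntry M s t) * (z t ^ 2 / 2) := by
        simp only [← Finset.sum_add_distrib]
        refine Finset.sum_congr rfl fun s _ => Finset.sum_congr rfl fun t _ => ?_
        ring
      rw [e4, e3, ← Finset.sum_add_distrib]
      simp only [← Finset.sum_add_distrib]
      rw [Finset.sum_comm]
      refine Finset.sum_congr rfl fun s _ => ?_
      rw [coxForm_simpleRoot, Finset.mul_sum]
      refine Finset.sum_congr rfl fun t _ => ?_
      ring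
    rw [e2] at e1
    refine le_trans (Finset.sum_nonneg fun t _ => ?_) e1
    by_cases ht : t ∈ J
    · exact mul_nonneg (mul_nonneg (sq_nonneg _) (hy0 t)) (hys t ht)
    · rw [hyJ t ht]; simp
  -- the norm of v vanishes
  have hq : coxForm M v v ≤ 0 := by
    let H : Set ℝ := {h | ∃ w ∈ Subgroup.closure (cs.simple '' J), h = ht (ρ w v)}
    have Hne : H.Nonempty := ⟨_, 1, one_mem _, rfl⟩
    have Hbd : BddBelow H := ⟨0, by rintro _ ⟨w, hw, rfl⟩; exact ht_nonneg (hpos w hw)⟩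
    have Hm : 0 ≤ sInf H := le_csInf Hne (by rintro _ ⟨w, hw, rfl⟩; exact ht_nonneg (hpos w hw))
    have main : ∀ δ : ℝ, 0 < δ → δ < 1 → coxForm M v v ≤ (sInf H + 1) * δ := by
      intro δ h0 h1
      obtain ⟨_, ⟨w, hw, rfl⟩, hlt⟩ := Real.lt_sInf_add_pos Hne h0
      have hs : ∀ s ∈ J, coxForm M (ρ w v) (simpleRoot s) ≤ δ := by
        intro s hs
        have : sInf H ≤ ht (ρ (cs.simple s * w) v) := csInf_le Hbd
          ⟨_, mul_mem (Subgroup.subset_closure ⟨s, hs, rfl⟩) hw, rfl⟩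
        rw [rho_mul, hρ, ht_sub, ht_smul, ht_simpleRoot, coxForm_comm] at this
        linarith
      rw [← form_inv M cs ρ hρ w v v, coxForm_eq_sum]
      have : ∑ s, ρ w v s * coxForm M (ρ w v) (simpleRoot s) ≤ ∑ s, ρ w v s * δ := by
        refine Finset.sum_le_sum fun s _ => ?_
        by_cases hsJ : s ∈ J
        · exact mul_le_mul_of_nonneg_left (hs s hsJ) (hpos w hw s)
        · rw [parabolic_coeff M cs ρ hρ J w hw v s hsJ, hv s hsJ]; simp
      rw [← Finset.sum_mul] at this
      change _ ≤ ht (ρ w v) * δ at this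
      nlinarith
    by_contra hcon
    push Not at hcon
    set q := coxForm M v v
    set m := sInf H
    have hd : 0 < q / (2 * (m + 1) + q) := by positivity
    have h2 := main (q / (2 * (m + 1) + q)) hd (by rw [div_lt_one (by positivity)]; linarith)
    rw [← mul_div_assoc, le_div_iff₀ (by positivity)] at h2
    nlinarith
  have hrad : ∀ s ∈ J, coxForm M v (simpleRoot s) = 0 := by
    intro s hs
    set b := coxForm M v (simpleRoot s) with hb
    have h1 := psd (v - (b / 2) • simpleRoot s) (by
      intro i hi
      have : i ≠ s := by rintro rfl; exact hi hs
      simp [simpleRoot, this, hv i hi])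
    simp only [coxForm_sub_left, coxForm_sub_right, coxForm_smul_left, coxForm_smul_right,
      coxForm_simpleRoot_simpleRoot, coxEntry_self] at h1
    rw [coxForm_comm M (simpleRoot s) v, ← hb] at h1
    nlinarith
  refine subset_closure ⟨1, one_mem _, v, ⟨?_, hv, fun s hs => (hrad s hs).le⟩, ?_⟩
  · intro i
    have := hpos 1 (one_mem _) i
    rwa [rho_one] at this
  · rw [rho_one]

lemma gordan (J : Set B) :
    (∃ x : B → ℝ, (∀ i, 0 ≤ x i) ∧ (∀ i ∉ J, x i = 0) ∧
      ∀ s ∈ J, coxForm M x (simpleRoot s) < 0) ∨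
    (∃ y : B → ℝ, (∀ i, 0 ≤ y i) ∧ (∀ i ∉ J, y i = 0) ∧ (∃ i, y i ≠ 0) ∧
      ∀ s ∈ J, 0 ≤ coxForm M y (simpleRoot s)) := by
  classical
  by_cases hcase : (∃ x : B → ℝ, (∀ i, 0 ≤ x i) ∧ (∀ i ∉ J, x i = 0) ∧
      ∀ s ∈ J, coxForm M x (simpleRoot s) < 0)
  · exact Or.inl hcase
  right
  let a : Set (B → ℝ) := {z | ∀ s ∈ J, z s < 0}
  let C : Set (B → ℝ) := {x | (∀ i, 0 ≤ x i) ∧ (∀ i ∉ J, x i = 0)}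
  let L : (B → ℝ) →ₗ[ℝ] (B → ℝ) :=
    { toFun := fun x s => coxForm M x (simpleRoot s)
      map_add' := fun x y => by ext s; exact coxForm_add_left M x y _
      map_smul' := fun c x => by ext s; exact coxForm_smul_left M c x _ }
  have ha_open : IsOpen a := by
    have : a = ⋂ s ∈ J, {z : B → ℝ | z s < 0} := by ext; simp [a]
    rw [this]
    exact (Set.toFinite J).isOpen_biInter fun s _ =>
      isOpen_lt (continuous_apply s) continuous_const
  have ha_conv : Convex ℝ a := by
    intro x hx y hy p q hp hq hpq s hs
    have h1 := hx s hs
    have h2 := hy s hs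
    simp only [Pi.add_apply, Pi.smul_apply, smul_eq_mul]
    rcases hp.eq_or_lt with h | h
    · subst h
      have : q = 1 := by linarith
      subst this; linarith
    · nlinarith
  have hC : Convex ℝ C := by
    intro x hx y hy p q hp hq hpq
    refine ⟨fun i => ?_, fun i hi => ?_⟩
    · exact add_nonneg (mul_nonneg hp (hx.1 i)) (mul_nonneg hq (hy.1 i))
    · simp [hx.2 i hi, hy.2 i hi]
  have hb_conv : Convex ℝ (L '' C) := hC.linear_image L
  have hdisj : Disjoint a (L '' C) := by
    rw [Set.disjoint_left]
    rintro _ hza ⟨x, hx, rfl⟩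
    exact hcase ⟨x, hx.1, hx.2, hza⟩
  obtain ⟨f, u, hfa, hfb⟩ := geometric_hahn_banach_open ha_conv ha_open hb_conv hdisj
  have hu : u ≤ 0 := by
    have := hfb 0 ⟨0, ⟨by simp, by simp⟩, map_zero L⟩
    simpa using this
  let z0 : B → ℝ := fun _ => -1
  have hz0 : z0 ∈ a := fun s _ => by simp [z0]
  let y : B → ℝ := fun s => f (simpleRoot s)
  have hfy : ∀ z : B → ℝ, f z = ∑ s, z s * y s := by
    intro z
    have : z = ∑ s, z s • simpleRoot s := by
      ext i; simp [simpleRoot, Finset.sum_apply, Pi.single_apply]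
    conv_lhs => rw [this]
    simp [y]
  have hline : ∀ s : B, ∀ t : ℝ, (s ∈ J → t ≤ 0) → f z0 + t * y s < 0 := by
    intro s t hst
    have : z0 + t • simpleRoot s ∈ a := by
      intro s' hs'
      by_cases h : s' = s
      · subst h
        have := hst hs'
        simp [z0, simpleRoot]; linarith
      · simp [z0, simpleRoot, h]
    have h2 := hfa _ this
    rw [map_add, map_smul] at h2
    change f z0 + t * y s < u at h2
    linarith
  have hf0 : f z0 < 0 := lt_of_lt_of_le (hfa _ hz0) hu
  refine ⟨y, ?_, ?_, ?_, ?_⟩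
  · intro s
    by_contra hneg
    push Not at hneg
    have h1 := hline s (f z0 / (- y s)) (fun _ => by
      apply div_nonpos_of_nonpos_of_nonneg hf0.le; linarith)
    have h2 := hline s (- (f z0) / y s) (fun _ => by
      apply div_nonpos_of_nonneg_of_nonpos <;> linarith)
    rw [div_mul_cancel₀ _ hneg.ne] at h2
    linarith
  · intro s hs
    by_contra hne
    have h2 := hline s (- (f z0) / y s) (fun h => absurd h hs)
    rw [div_mul_cancel₀ _ hne] at h2
    linarith
  · by_contra! hall
    rw [hfy] at hf0
    simp [hall] at hf0
  · intro s hs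
    have e : coxForm M y (simpleRoot s) = f (L (simpleRoot s)) := by
      rw [hfy, coxForm_comm, coxForm_eq_sum]
      refine Finset.sum_congr rfl fun t _ => ?_
      exact mul_comm _ _
    rw [e]
    by_contra hneg
    push Not at hneg
    set g := f (L (simpleRoot s)) with hg
    have h3 := hfb (L (((u - 1) / g) • simpleRoot s)) ⟨_, ⟨?_, ?_⟩, rfl⟩
    · rw [map_smul, map_smul, smul_eq_mul, ← hg, div_mul_cancel₀ _ hneg.ne] at h3
      linarith
    · intro i
      exact mul_nonneg (div_nonneg_of_nonpos (by linarith) hneg.le) (simpleRoot_nonneg s i)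
    · intro i hi
      have : i ≠ s := by rintro rfl; exact hi hs
      simp [simpleRoot, this]

lemma orth_form (T : Set B) (v : B → ℝ) (hv : ∀ i ∉ T, v i = 0) (s : B)
    (h : ∀ t ∈ T, coxEntry M s t = 0) : coxForm M (simpleRoot s) v = 0 := by
  rw [coxForm_comm, coxForm_simpleRoot]
  refine Finset.sum_eq_zero fun t _ => ?_
  by_cases ht : t ∈ T
  · rw [coxEntry_comm, h t ht, mul_zero]
  · rw [hv t ht, zero_mul]

lemma imagConeJ_add
    (hρ : ∀ (s : B) (v : B → ℝ),
      ρ (cs.simple s) v = v - coxForm M (simpleRoot s) v • simpleRoot s)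
    (J T T' : Set B) (hJ : J = T ∪ T')
    (horth : ∀ s ∈ T, ∀ t ∈ T', coxEntry M s t = 0) (a b : B → ℝ)
    (ha : a ∈ imagConeJ M cs ρ T) (hb : b ∈ imagConeJ M cs ρ T') :
    a + b ∈ imagConeJ M cs ρ J := by
  unfold imagConeJ at *
  refine map_mem_closure₂ continuous_add ha hb ?_
  rintro _ ⟨w, hw, k, hk, rfl⟩ _ ⟨w', hw', k', hk', rfl⟩
  have hTJ : T ⊆ J := hJ ▸ Set.subset_union_left
  have hTJ' : T' ⊆ J := hJ ▸ Set.subset_union_right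
  have horth' : ∀ s ∈ T', ∀ t ∈ T, coxEntry M s t = 0 := fun s hs t ht => by
    rw [coxEntry_comm]; exact horth t ht s hs
  refine ⟨w * w', mul_mem (Subgroup.closure_mono (Set.image_mono hTJ) hw)
    (Subgroup.closure_mono (Set.image_mono hTJ') hw'), k + k', ⟨?_, ?_, ?_⟩, ?_⟩
  · intro i; exact add_nonneg (hk.1 i) (hk'.1 i)
  · intro i hi
    simp [hk.2.1 i (fun h => hi (hTJ h)), hk'.2.1 i (fun h => hi (hTJ' h))]
  · intro s hs
    rw [coxForm_add_left]
    rw [hJ] at hs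
    rcases hs with hs | hs
    · rw [coxForm_comm M k', orth_form M T' k' hk'.2.1 s (horth s hs), add_zero]
      exact hk.2.2 s hs
    · rw [coxForm_comm M k, orth_form M T k hk.2.1 s (horth' s hs), zero_add]
      exact hk'.2.2 s hs
  · rw [rho_mul, map_add, map_add,
      parabolic_fix M cs ρ hρ T' k (fun s hs => orth_form M T k hk.2.1 s (horth' s hs)) w' hw',
      parabolic_fix M cs ρ hρ T (ρ w' k') (fun s hs => orth_form M T' _ (fun i hi => by
        rw [parabolic_coeff M cs ρ hρ T' w' hw' k' i hi, hk'.2.1 i hi]) s (horth s hs)) w hw]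

lemma restrict_pos
    (hρ : ∀ (s : B) (v : B → ℝ),
      ρ (cs.simple s) v = v - coxForm M (simpleRoot s) v • simpleRoot s)
    (J T T' : Set B) (hTJ : T ⊆ J) (hTT : ∀ i ∈ T, i ∉ T')
    (horth : ∀ s ∈ T, ∀ t ∈ T', coxEntry M s t = 0) (a b : B → ℝ)
    (ha : ∀ i, 0 ≤ a i) (hb : ∀ i ∉ T', b i = 0)
    (hpos : ∀ w ∈ Subgroup.closure (cs.simple '' J), ∀ i, 0 ≤ ρ w (a + b) i) :
    ∀ w ∈ Subgroup.closure (cs.simple '' T), ∀ i, 0 ≤ ρ w a i := by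
  intro w hw i
  by_cases hi : i ∈ T
  · have h1 := hpos w (Subgroup.closure_mono (Set.image_mono hTJ) hw) i
    rw [map_add, parabolic_fix M cs ρ hρ T b
      (fun s hs => orth_form M T' b hb s (horth s hs)) w hw] at h1
    simpa [hb i (hTT i hi)] using h1
  · rw [parabolic_coeff M cs ρ hρ T w hw a i hi]; exact ha i

theorem dual_subset
    (hρ : ∀ (s : B) (v : B → ℝ),
      ρ (cs.simple s) v = v - coxForm M (simpleRoot s) v • simpleRoot s)
    (J : Set B) (v : B → ℝ) (hv : ∀ i ∉ J, v i = 0)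
    (hpos : ∀ w ∈ Subgroup.closure (cs.simple '' J), ∀ i, 0 ≤ ρ w v i) :
    v ∈ imagConeJ M cs ρ J := by
  classical
  induction hn : J.ncard using Nat.strong_induction_on generalizing J v with
  | _ n IH =>
  subst hn
  rcases gordan M J with ⟨x, hx, hxJ, hxs⟩ | ⟨y, hy, hyJ, ⟨i0, hi0⟩, hys⟩
  · exact case_strict M cs ρ hρ J v hv hpos x hx hxJ hxs
  by_cases hfull : ∀ i ∈ J, y i ≠ 0
  · exact case_psd M cs ρ hρ J v hv hpos y
      (fun i hi => lt_of_le_of_ne (hy i) (hfull i hi).symm) hyJ hys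
  push Not at hfull
  obtain ⟨j0, hj0, hj0'⟩ := hfull
  let T : Set B := {i | y i ≠ 0}
  let T' : Set B := J \ T
  have hTJ : T ⊆ J := fun i hi => by
    by_contra h; exact hi (hyJ i h)
  have hJ : J = T ∪ T' := (Set.union_sdiff_cancel hTJ).symm
  have horth' : ∀ s ∈ T', ∀ t ∈ T, coxEntry M s t = 0 := by
    intro s hs t ht
    have h1 := hys s hs.1
    have hys0 : y s = 0 := by
      by_contra h; exact hs.2 h
    rw [coxForm_simpleRoot] at h1
    have hterm : ∀ t ∈ Finset.univ, y t * coxEntry M t s ≤ 0 := by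
      intro t _
      by_cases h : t = s
      · subst h; simp [hys0]
      · exact mul_nonpos_of_nonneg_of_nonpos (hy t) (coxEntry_nonpos M h)
    have h2 := (Finset.sum_eq_zero_iff_of_nonpos hterm).1
      (le_antisymm (Finset.sum_nonpos hterm) h1) t (Finset.mem_univ t)
    rw [coxEntry_comm]
    exact (mul_eq_zero.1 h2).resolve_left ht
  have horth : ∀ s ∈ T, ∀ t ∈ T', coxEntry M s t = 0 := fun s hs t ht => by
    rw [coxEntry_comm]; exact horth' t ht s hs
  have hv0 : ∀ i, 0 ≤ v i := fun i => by
    have := hpos 1 (one_mem _) i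
    rwa [rho_one] at this
  let a : B → ℝ := fun i => if i ∈ T then v i else 0
  let b : B → ℝ := fun i => if i ∈ T then 0 else v i
  have hab : v = a + b := by
    ext i; by_cases h : i ∈ T <;> simp [a, b, h]
  have ha0 : ∀ i, 0 ≤ a i := fun i => by
    by_cases h : i ∈ T <;> simp [a, h, hv0 i]
  have hb0 : ∀ i, 0 ≤ b i := fun i => by
    by_cases h : i ∈ T <;> simp [b, h, hv0 i]
  have haT : ∀ i ∉ T, a i = 0 := fun i hi => by simp [a, hi]
  have hbT : ∀ i ∉ T', b i = 0 := fun i hi => by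
    by_cases h : i ∈ T
    · simp [b, h]
    · have : i ∉ J := fun hJ => hi ⟨hJ, h⟩
      simp [b, h, hv i this]
  have hT'J : T' ⊆ J := Set.sdiff_subset
  have p1 := restrict_pos M cs ρ hρ J T T' hTJ (fun i hi h => h.2 hi) horth a b ha0 hbT
    (hab ▸ hpos)
  have p2 := restrict_pos M cs ρ hρ J T' T hT'J (fun i hi h => hi.2 h) horth' b a hb0 haT
    (by rw [add_comm, ← hab]; exact hpos)
  have c1 : T.ncard < J.ncard := Set.ncard_lt_ncard
    (Set.ssubset_iff_subset_ne.2 ⟨hTJ, fun h => (h ▸ hj0 : j0 ∈ T) hj0'⟩) (Set.toFinite J)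
  have c2 : T'.ncard < J.ncard := Set.ncard_lt_ncard
    (Set.ssubset_iff_subset_ne.2 ⟨hT'J, fun h => (h ▸ hTJ hi0 : i0 ∈ T').2 hi0⟩) (Set.toFinite J)
  rw [hab]
  exact imagConeJ_add M cs ρ hρ J T T' hJ horth a b
    (IH _ c1 T a haT p1 rfl) (IH _ c2 T' b hbT p2 rfl)

end Helpers

/-!
STATEMENT 4: For J ⊆ S, the closed imaginary cone I_J of the parabolic subsystem (W_J, J) is
contained in I.  Moreover, if v ∈ I is a nonnegative combination of the simple roots α_{s'}
with s' ∈ J and all coefficients nonzero, then v ∈ I_J.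
-/
theorem imagConeJ_subset_and_support_criterion
    {B : Type*} [Fintype B] [DecidableEq B] (M : CoxeterMatrix B)
    {W : Type*} [Group W] (cs : CoxeterSystem M W)
    (ρ : W →* ((B → ℝ) ≃ₗ[ℝ] (B → ℝ)))
    (hρ : ∀ (s : B) (v : B → ℝ),
      ρ (cs.simple s) v = v - coxForm M (simpleRoot s) v • simpleRoot s)
    (J : Set B) :
    imagConeJ M cs ρ J ⊆ imagCone M ρ ∧
      ∀ v ∈ imagCone M ρ, (∀ i, 0 ≤ v i) → (∀ i ∉ J, v i = 0) → (∀ i ∈ J, v i ≠ 0) →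
        v ∈ imagConeJ M cs ρ J := by
  constructor
  · refine closure_mono ?_
    rintro _ ⟨w, _, k, hk, rfl⟩
    refine ⟨w, k, ⟨hk.1, fun s => ?_⟩, rfl⟩
    by_cases hs : s ∈ J
    · exact hk.2.2 s hs
    · rw [coxForm_simpleRoot]
      apply Finset.sum_nonpos
      intro t _
      by_cases ht : t = s
      · subst ht; simp [hk.2.1 _ hs]
      · exact mul_nonpos_of_nonneg_of_nonpos (hk.1 t) (coxEntry_nonpos M ht)
  · intro v hv _ hvJ _
    refine dual_subset M cs ρ hρ J v hvJ fun w _ i => ?_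
    have hcl : IsClosed {u : B → ℝ | 0 ≤ ρ w u i} := by
      have hc : Continuous fun u : B → ℝ => ρ w u :=
        LinearMap.continuous_of_finiteDimensional (ρ w : (B → ℝ) →ₗ[ℝ] (B → ℝ))
      exact isClosed_le continuous_const ((continuous_apply i).comp hc)
    refine closure_minimal ?_ hcl hv
    rintro _ ⟨w', k, hk, rfl⟩
    change 0 ≤ ρ w (ρ w' k) i
    rw [← rho_mul]
    exact coneK_orbit_nonneg M cs ρ hρ k hk (w * w') i
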